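/- arXiv:2403.02092 — 2 statements merged into one kernel-verified Lean document; each statement's English description precedes it below -/
import Mathlib

section
/- Let (Σ,σ) be a topologically transitive countable Markov shift with the F-property, and let φ : Σ → ℝ have summable variations, Gurevich pressure P(φ) < ∞, and entropy at infinity h_∞ = 0. If φ is strongly positive recurrent, then χ_per(φ) := sup{(1/n)S_nφ(x) : σ^n x = x, n ∈ ℕ} < P(φ), i.e. (UCS) holds. -/
open Filter Set MeasureTheory Real ENNReal

namespace CMS

/-- Points of the full sequence space over the alphabet `ℕ`. -/
abbrev Pt : Type := ℕ → ℕ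

/-- The (left) shift map `σ`. -/
def shiftMap : Pt → Pt := fun x i => x (i + 1)

/-- `x` is a point of the countable Markov shift `Σ` determined by the
transition matrix `M` (identified with a relation on the alphabet `ℕ`). -/
def isAdmissible (M : ℕ → ℕ → Prop) (x : Pt) : Prop := ∀ i, M (x i) (x (i + 1))

/-- Topological transitivity: for all states `a, b` there is `N` with
`[a] ∩ σ⁻ᴺ [b] ≠ ∅`. -/
def TopTransitive (M : ℕ → ℕ → Prop) : Prop :=
  ∀ a b : ℕ, ∃ (N : ℕ) (x : Pt), isAdmissible M x ∧ x 0 = a ∧ x N = b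

/-- Birkhoff sum `S_n φ`. -/
noncomputable def birkhoff (φ : Pt → ℝ) (n : ℕ) (x : Pt) : ℝ :=
  ∑ i ∈ Finset.range n, φ (shiftMap^[i] x)

/-- `φ` has summable variations: `∑_{k ≥ 2} var_k(φ) < ∞`, expressed via a summable
sequence dominating the `k`-th variations. -/
def SummableVariations (M : ℕ → ℕ → Prop) (φ : Pt → ℝ) : Prop :=
  ∃ V : ℕ → ℝ, Summable V ∧
    ∀ k, 2 ≤ k → ∀ x y : Pt, isAdmissible M x → isAdmissible M y →
      (∀ i < k, x i = y i) → |φ x - φ y| ≤ V k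

/-- `φ` is weakly Hölder continuous: `var_k(φ) ≤ C θ^k` for all `k ≥ 2`. -/
def WeaklyHolder (M : ℕ → ℕ → Prop) (φ : Pt → ℝ) : Prop :=
  ∃ C θ : ℝ, 0 < C ∧ 0 < θ ∧ θ < 1 ∧
    ∀ k, 2 ≤ k → ∀ x y : Pt, isAdmissible M x → isAdmissible M y →
      (∀ i < k, x i = y i) → |φ x - φ y| ≤ C * θ ^ k

/-- Periodic points of period `n` in the 1-cylinder `[a]`. -/
def PerSet (M : ℕ → ℕ → Prop) (a n : ℕ) : Set Pt :=
  {x | isAdmissible M x ∧ shiftMap^[n] x = x ∧ x 0 = a}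

/-- Periodic points of period `n` in `[a]` whose first return time to `[a]` is `n`. -/
def PerStarSet (M : ℕ → ℕ → Prop) (a n : ℕ) : Set Pt :=
  {x | isAdmissible M x ∧ shiftMap^[n] x = x ∧ x 0 = a ∧ ∀ k, 0 < k → k < n → x k ≠ a}

/-- The Gurevich partition function `Z_n(φ, a)`. -/
noncomputable def Zn (M : ℕ → ℕ → Prop) (φ : Pt → ℝ) (a n : ℕ) : ℝ≥0∞ :=
  ∑' x : PerSet M a n, ENNReal.ofReal (Real.exp (birkhoff φ n x.1))

/-- The first-return partition function `Z_n^*(φ, a)`. -/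
noncomputable def ZnStar (M : ℕ → ℕ → Prop) (φ : Pt → ℝ) (a n : ℕ) : ℝ≥0∞ :=
  ∑' x : PerStarSet M a n, ENNReal.ofReal (Real.exp (birkhoff φ n x.1))

/-- The Gurevich pressure at the state `a`:
`P(φ) = limsup_n (1/n) log Z_n(φ, a)`, with values in `EReal`. -/
noncomputable def pressureAt (M : ℕ → ℕ → Prop) (φ : Pt → ℝ) (a : ℕ) : EReal :=
  Filter.limsup (fun n : ℕ => ((n : ℝ)⁻¹ : EReal) * ENNReal.log (Zn M φ a n)) atTop

/-- `limsup_n (1/n) log Z_n^*(φ, a)`, with values in `EReal`. -/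
noncomputable def pressureStarAt (M : ℕ → ℕ → Prop) (φ : Pt → ℝ) (a : ℕ) : EReal :=
  Filter.limsup (fun n : ℕ => ((n : ℝ)⁻¹ : EReal) * ENNReal.log (ZnStar M φ a n)) atTop

/-- Strong positive recurrence of `φ`, relative to the common value `P` of the
Gurevich pressure: for some state `a`, `limsup_n (1/n) log Z_n^*(φ,a) < P(φ)`. -/
def SPR (M : ℕ → ℕ → Prop) (φ : Pt → ℝ) (P : ℝ) : Prop :=
  ∃ a : ℕ, pressureStarAt M φ a < (P : EReal)

/-- The `F`-property: for every state `a` and every `n ≥ 1` there are only finitely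
many periodic points of period `n` in `[a]`. -/
def FProperty (M : ℕ → ℕ → Prop) : Prop :=
  ∀ a n : ℕ, 0 < n → (PerSet M a n).Finite

/-- `χ_per(φ) = sup { (1/n) S_n φ(x) : σ^n x = x, n ∈ ℕ }`, with values in `EReal`. -/
noncomputable def chiPer (M : ℕ → ℕ → Prop) (φ : Pt → ℝ) : EReal :=
  ⨆ p : {p : Pt × ℕ // isAdmissible M p.1 ∧ 0 < p.2 ∧ shiftMap^[p.2] p.1 = p.1},
    ((birkhoff φ p.1.2 p.1.1 / (p.1.2 : ℝ) : ℝ) : EReal)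

/-- `x` lies in a cylinder belonging to `B(n, M', q)`: it is admissible,
`x 0 ≤ q`, `x n ≤ q` and `#{0 ≤ k ≤ n : x k ≤ q} ≤ (n+1)/M'`. -/
def inBSet (M : ℕ → ℕ → Prop) (n M' q : ℕ) (x : Pt) : Prop :=
  isAdmissible M x ∧ x 0 ≤ q ∧ x n ≤ q ∧
    ((((Finset.range (n + 1)).filter (fun k => x k ≤ q)).card : ℝ) ≤ (n + 1 : ℝ) / (M' : ℝ))

/-- `z_{φ,n}(M',q) = sup { (1/n) S_n φ(x) : x ∈ B for some B ∈ B(n,M',q) }`. -/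
noncomputable def zPhi (M : ℕ → ℕ → Prop) (φ : Pt → ℝ) (n M' q : ℕ) : EReal :=
  ⨆ x : {x : Pt // inBSet M n M' q x}, ((birkhoff φ n x.1 / (n : ℝ) : ℝ) : EReal)

/-- The contraction at infinity
`δ_{φ,∞} = lim_{q→∞} lim_{M'→∞} limsup_{n→∞} z_{φ,n}(M',q)`
(the inner limits exist by monotonicity, so they agree with `liminf`s). -/
noncomputable def deltaInf (M : ℕ → ℕ → Prop) (φ : Pt → ℝ) : EReal :=
  liminf (fun q : ℕ => liminf (fun M' : ℕ =>
    limsup (fun n : ℕ => zPhi M φ n M' q) atTop) atTop) atTop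

/-- `z_n(M',q) = #B(n,M',q)`, the number of `(n+1)`-cylinders (i.e. admissible
words realized in `Σ`) in `B(n,M',q)`, counted in `ℝ≥0∞`. -/
noncomputable def zCount (M : ℕ → ℕ → Prop) (n M' q : ℕ) : ℝ≥0∞ :=
  ∑' _w : {w : Fin (n + 1) → ℕ //
      (∃ x : Pt, isAdmissible M x ∧ ∀ i : Fin (n + 1), x (i : ℕ) = w i) ∧
      w 0 ≤ q ∧ w (Fin.last n) ≤ q ∧
      (((Finset.univ.filter (fun i : Fin (n + 1) => w i ≤ q)).card : ℝ) ≤ (n + 1 : ℝ) / (M' : ℝ))},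
    (1 : ℝ≥0∞)

/-- The entropy at infinity
`h_∞ = lim_{q→∞} lim_{M'→∞} limsup_{n→∞} (1/n) log z_n(M',q)`. -/
noncomputable def hInfty (M : ℕ → ℕ → Prop) : EReal :=
  liminf (fun q : ℕ => liminf (fun M' : ℕ =>
    limsup (fun n : ℕ => ((n : ℝ)⁻¹ : EReal) * ENNReal.log (zCount M n M' q)) atTop) atTop) atTop

end CMS

open CMS

namespace CMS

theorem shift_iterate_apply (n : ℕ) (x : Pt) (i : ℕ) : shiftMap^[n] x i = x (n + i) := by
  induction n generalizing x with
  | zero => simp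
  | succ n ih =>
    rw [Function.iterate_succ_apply, ih]
    simp only [shiftMap]
    congr 1
    omega

theorem isAdmissible.shift {M : ℕ → ℕ → Prop} {x : Pt} (hx : isAdmissible M x) (n : ℕ) :
    isAdmissible M (shiftMap^[n] x) := by
  intro i
  simpa only [shift_iterate_apply, add_assoc] using hx (n + i)

theorem birkhoff_add (φ : Pt → ℝ) (m n : ℕ) (x : Pt) :
    birkhoff φ (m + n) x = birkhoff φ m x + birkhoff φ n (shiftMap^[m] x) := by
  simp only [birkhoff, Finset.sum_range_add, ← Function.iterate_add_apply, add_comm]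

theorem birkhoff_succ' (φ : Pt → ℝ) (n : ℕ) (x : Pt) :
    birkhoff φ (n + 1) x = φ x + birkhoff φ n (shiftMap x) := by
  rw [add_comm n 1, birkhoff_add]
  simp [birkhoff]

theorem birkhoff_sub_const (φ : Pt → ℝ) (c : ℝ) (n : ℕ) (x : Pt) :
    birkhoff (fun y => φ y - c) n x = birkhoff φ n x - n * c := by
  simp [birkhoff, Finset.sum_sub_distrib]

theorem shift_iterate_mul {n : ℕ} {x : Pt} (hx : shiftMap^[n] x = x) (k : ℕ) :
    shiftMap^[k * n] x = x := by
  rw [mul_comm, Function.iterate_mul]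
  exact Function.iterate_fixed hx k

theorem birkhoff_mul (φ : Pt → ℝ) {n : ℕ} {x : Pt} (hx : shiftMap^[n] x = x) (k : ℕ) :
    birkhoff φ (k * n) x = k * birkhoff φ n x := by
  induction k with
  | zero => simp [birkhoff]
  | succ k ih =>
    rw [Nat.succ_mul, birkhoff_add, ih, shift_iterate_mul hx]
    push_cast
    ring

/-- The number of times `0 ≤ i < n` at which `x` visits the state `a`. -/
def visits (a n : ℕ) (x : Pt) : ℕ := ∑ i ∈ Finset.range n, if x i = a then 1 else 0

theorem visits_add (a m n : ℕ) (x : Pt) :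
    visits a (m + n) x = visits a m x + visits a n (shiftMap^[m] x) := by
  simp only [visits, Finset.sum_range_add, shift_iterate_apply]

theorem visits_succ' (a n : ℕ) (x : Pt) :
    visits a (n + 1) x = (if x 0 = a then 1 else 0) + visits a n (shiftMap x) := by
  rw [add_comm n 1, visits_add]
  simp only [visits, Finset.sum_range_one]
  rfl

theorem visits_mul (a : ℕ) {n : ℕ} {x : Pt} (hx : shiftMap^[n] x = x) (k : ℕ) :
    visits a (k * n) x = k * visits a n x := by
  induction k with
  | zero => simp [visits]
  | succ k ih => rw [Nat.succ_mul, visits_add, ih, shift_iterate_mul hx, Nat.succ_mul]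

/-- The sequence that follows `x` for `n` steps and then continues as `z`. -/
def glue (n : ℕ) (x z : Pt) : Pt := fun i => if i < n then x i else z (i - n)

theorem glue_of_lt {n i : ℕ} (x z : Pt) (h : i < n) : glue n x z i = x i := by simp [glue, h]

theorem glue_add (n i : ℕ) (x z : Pt) : glue n x z (n + i) = z i := by simp [glue]

theorem glue_of_le {n i : ℕ} {x z : Pt} (h : x n = z 0) (hi : i ≤ n) : glue n x z i = x i := by
  rcases hi.lt_or_eq with hi | rfl
  · exact glue_of_lt x z hi
  · rw [h]
    exact glue_add i 0 x z

theorem shift_glue (n : ℕ) (x z : Pt) : shiftMap^[n] (glue n x z) = z := by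
  ext i
  rw [shift_iterate_apply, glue_add]

theorem isAdmissible.glue {M : ℕ → ℕ → Prop} {x z : Pt} {n : ℕ} (hx : isAdmissible M x)
    (hz : isAdmissible M z) (h : x n = z 0) : isAdmissible M (glue n x z) := by
  intro i
  rcases lt_or_ge i n with hi | hi
  · rw [glue_of_lt x z hi, glue_of_le h hi]
    exact hx i
  · obtain ⟨k, rfl⟩ := Nat.exists_eq_add_of_le hi
    rw [add_assoc, glue_add, glue_add]
    exact hz k

/-- The periodic sequence that repeats the first `n` symbols of `x`. -/
def periodize (n : ℕ) (x : Pt) : Pt := fun i => x (i % n)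

theorem periodize_of_lt {n i : ℕ} (x : Pt) (h : i < n) : periodize n x i = x i := by
  simp [periodize, Nat.mod_eq_of_lt h]

theorem periodize_of_le {n i : ℕ} {x : Pt} (h : x n = x 0) (hi : i ≤ n) :
    periodize n x i = x i := by
  rcases hi.lt_or_eq with hi | rfl
  · exact periodize_of_lt x hi
  · simp [periodize, h]

theorem shift_periodize (n : ℕ) (x : Pt) : shiftMap^[n] (periodize n x) = periodize n x := by
  ext i
  simp [shift_iterate_apply, periodize]

theorem isAdmissible.periodize {M : ℕ → ℕ → Prop} {x : Pt} {n : ℕ} (hn : 0 < n)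
    (hx : isAdmissible M x) (h : x n = x 0) : isAdmissible M (periodize n x) := by
  intro i
  have key : x ((i + 1) % n) = x (i % n + 1) := by
    rw [Nat.add_mod_eq_ite]
    rcases Nat.eq_or_lt_of_le hn with rfl | h1
    · simp [Nat.mod_one, h]
    · rw [Nat.mod_eq_of_lt h1]
      have := Nat.mod_lt i hn
      split_ifs with h2
      · have h3 : i % n + 1 = n := by omega
        rw [h3, h]
        simp
      · rfl
  simp only [CMS.periodize, key]
  exact hx _

/-- `V` bounds the variations of `φ` and its partial absolute sums are at most `D`. -/
structure VarBound (M : ℕ → ℕ → Prop) (φ : Pt → ℝ) (V : ℕ → ℝ) (D : ℝ) : Prop where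
  var_le : ∀ k, 2 ≤ k → ∀ x y : Pt, isAdmissible M x → isAdmissible M y →
    (∀ i < k, x i = y i) → |φ x - φ y| ≤ V k
  sum_le : ∀ s : ℕ, ∑ i ∈ Finset.range s, |V i| ≤ D

namespace VarBound

variable {M : ℕ → ℕ → Prop} {φ : Pt → ℝ} {V : ℕ → ℝ} {D : ℝ}

theorem nonneg (h : VarBound M φ V D) : 0 ≤ D := by simpa using h.sum_le 0

theorem sub_const (h : VarBound M φ V D) (c : ℝ) : VarBound M (fun y => φ y - c) V D where
  var_le k hk x y hx hy hxy := by simpa using h.var_le k hk x y hx hy hxy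
  sum_le := h.sum_le

theorem birkhoff_sub_le (h : VarBound M φ V D) (n : ℕ) (x y : Pt) (hx : isAdmissible M x)
    (hy : isAdmissible M y) (hxy : ∀ i ≤ n, x i = y i) :
    |birkhoff φ n x - birkhoff φ n y| ≤ D := by
  refine le_trans ?_ (h.sum_le (n + 2))
  induction n generalizing x y with
  | zero =>
    simp only [birkhoff, Finset.range_zero, Finset.sum_empty, sub_zero, abs_zero]
    exact Finset.sum_nonneg fun i _ => abs_nonneg _
  | succ n ih =>
    rw [birkhoff_succ', birkhoff_succ', Finset.sum_range_succ, add_sub_add_comm, add_comm]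
    refine (abs_add_le _ _).trans (add_le_add ?_ ?_)
    · exact ih _ _ (hx.shift 1) (hy.shift 1) fun i hi => hxy (i + 1) (by omega)
    · exact (h.var_le _ (by omega) x y hx hy fun i hi => hxy i (by omega)).trans (le_abs_self _)

theorem le_birkhoff_glue (h : VarBound M φ V D) {n m : ℕ} {x z : Pt} (hx : isAdmissible M x)
    (hz : isAdmissible M z) (hxz : x n = z 0) :
    birkhoff φ n x - D + birkhoff φ m z ≤ birkhoff φ (n + m) (glue n x z) := by
  rw [birkhoff_add, shift_glue]
  have := abs_le.1 (h.birkhoff_sub_le n (glue n x z) x (hx.glue hz hxz) hx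
    fun i hi => glue_of_le hxz hi)
  linarith [this.1]

end VarBound

/-- In a family of loops at `a` realizing a word with at most one more loop inserted after each
visit to `a`, the exponential weights add up to a binomial expression. -/
theorem exists_insertions {M : ℕ → ℕ → Prop} {φ : Pt → ℝ} {V : ℕ → ℝ} {D K : ℝ} {a : ℕ}
    (hV : VarBound M φ V D)
    (hloop : ∀ x : Pt, ∃ (g : Pt) (p : ℕ), isAdmissible M g ∧ 0 < p ∧ g 0 = a ∧ g p = a ∧
      (∀ i, 0 < i → i < p → g i ≠ a) ∧ (∃ i ≤ p, x i ≠ g i) ∧ -K ≤ birkhoff φ p g)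
    (z : Pt) (T : ℕ) (x : Pt) (hx : isAdmissible M x) (hxz : shiftMap^[T] x = z) :
    ∃ (ι : Type) (_ : Fintype ι) (N : ι → ℕ) (y : ι → Pt) (j : ι → ℕ) (r : ι → ℝ),
      Function.Injective (fun i => (N i, y i)) ∧
      (∀ i, T ≤ N i ∧ isAdmissible M (y i) ∧ shiftMap^[N i] (y i) = z ∧ 1 ≤ j i ∧
        (∀ l < j i, y i l = x l) ∧ (∀ l, (∀ k < l, x k ≠ a) → y i l = x l) ∧
        r i - ∑ l ∈ Finset.range (j i + 1), |V l| ≤ birkhoff φ (N i) (y i)) ∧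
      ∑ i, Real.exp (r i) =
        Real.exp (birkhoff φ T x) * (1 + Real.exp (-(K + 2 * D))) ^ visits a T x := by
  induction T generalizing x with
  | zero =>
    refine ⟨Unit, inferInstance, fun _ => 0, fun _ => x, fun _ => 1, fun _ => 0,
      fun _ _ _ => rfl, fun _ => ⟨le_rfl, hx, hxz, le_rfl, fun _ _ => rfl, fun _ _ => rfl, ?_⟩, ?_⟩
    · simp only [birkhoff, Finset.range_zero, Finset.sum_empty, zero_sub, neg_nonpos]
      exact Finset.sum_nonneg fun i _ => abs_nonneg _
    · simp [birkhoff, visits]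
  | succ T ih =>
    obtain ⟨ι, hι, N, y, j, r, hinj, hy, hsum⟩ := ih (shiftMap x) (hx.shift 1) hxz
    have hy0 : ∀ i, x 1 = y i 0 := fun i => ((hy i).2.2.2.2.2.1 0 (by simp)).symm
    let y' : ι → Pt := fun i => glue 1 x (y i)
    have hadm : ∀ i, isAdmissible M (y' i) := fun i => hx.glue (hy i).2.1 (hy0 i)
    have hy'0 : ∀ i, y' i 0 = x 0 := fun i => glue_of_lt _ _ one_pos
    have hy's : ∀ i l, y' i (l + 1) = y i l := fun i l => by
      rw [add_comm]; exact glue_add 1 l x (y i)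
    have hshift : ∀ i, shiftMap^[N i + 1] (y' i) = z := fun i => by
      rw [Function.iterate_add_apply, shift_glue, (hy i).2.2.1]
    have hinj' : ∀ i i', N i = N i' → y' i = y' i' → i = i' := by
      intro i i' h1 h2
      have h3 := congrArg (shiftMap^[1]) h2
      simp only [y', shift_glue] at h3
      exact hinj (Prod.ext h1 h3)
    have hagree : ∀ i, ∀ l < j i + 1, y' i l = x l := by
      rintro i (_ | l) hl
      · exact hy'0 i
      · rw [hy's]; exact (hy i).2.2.2.2.1 l (by omega)
    have hfirst : ∀ i l, (∀ k, 0 < k → k < l → x k ≠ a) → y' i l = x l := by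
      rintro i (_ | l) hl
      · exact hy'0 i
      · rw [hy's]; exact (hy i).2.2.2.2.2.1 l fun k hk => hl (k + 1) (by omega) (by omega)
    have hw : ∀ i, (r i + φ x) - ∑ l ∈ Finset.range (j i + 1 + 1), |V l| ≤
        birkhoff φ (N i + 1) (y' i) := by
      intro i
      have h1 := hV.var_le (j i + 1) (by have := (hy i).2.2.2.1; omega) _ _ (hadm i) hx (hagree i)
      have h2 : shiftMap (y' i) = y i := shift_glue 1 x (y i)
      rw [Finset.sum_range_succ, birkhoff_succ', h2]
      have h3 := (hy i).2.2.2.2.2.2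
      have h4 := (abs_le.1 h1).1
      have h5 := le_abs_self (V (j i + 1))
      linarith
    by_cases hxa : x 0 = a
    · obtain ⟨g, p, hg, hp, hg0, hgp, hgi, hne, hgK⟩ := hloop x
      have hgl : ∀ i, g p = y' i 0 := fun i => by rw [hgp, hy'0, hxa]
      have hcross : ∀ i i', y' i ≠ glue p g (y' i') := by
        intro i i' h
        have hg' : ∀ l ≤ p, y' i l = g l := fun l hl => by rw [h]; exact glue_of_le (hgl i') hl
        have : ∀ l ≤ p, x l = g l := by
          intro l
          induction l using Nat.strong_induction_on with
          | _ l ihl =>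
            intro hl
            rw [← hg' l hl, hfirst i l]
            intro k hk hkl
            rw [ihl k hkl (by omega)]
            exact hgi k hk (by omega)
        obtain ⟨l, hl, hl'⟩ := hne
        exact hl' (this l hl)
      refine ⟨ι ⊕ ι, inferInstance, Sum.elim (fun i => N i + 1) (fun i => p + (N i + 1)),
        Sum.elim y' (fun i => glue p g (y' i)), Sum.elim (fun i => j i + 1) (fun _ => 1),
        Sum.elim (fun i => r i + φ x) (fun i => r i + φ x - (K + 2 * D)), ?_, ?_, ?_⟩
      · rintro (i | i) (i' | i') h
        · simp only [Sum.elim_inl, Prod.mk.injEq, Nat.add_right_cancel_iff] at h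
          rw [hinj' i i' h.1 h.2]
        · simp only [Sum.elim_inl, Sum.elim_inr, Prod.mk.injEq] at h
          exact (hcross _ _ h.2).elim
        · simp only [Sum.elim_inl, Sum.elim_inr, Prod.mk.injEq] at h
          exact (hcross _ _ h.2.symm).elim
        · simp only [Sum.elim_inr, Prod.mk.injEq] at h
          have h3 := congrArg (shiftMap^[p]) h.2
          simp only [shift_glue] at h3
          rw [hinj' i i' (by omega) h3]
      · rintro (i | i)
        · exact ⟨Nat.succ_le_succ (hy i).1, hadm i, hshift i, by simp, hagree i,
            fun l hl => hfirst i l fun k _ hk => hl k hk, hw i⟩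
        · simp only [Sum.elim_inr]
          refine ⟨by have := (hy i).1; omega, hg.glue (hadm i) (hgl i), ?_, le_rfl, ?_, ?_, ?_⟩
          · rw [add_comm, Function.iterate_add_apply, shift_glue, hshift]
          · intro l hl
            obtain rfl : l = 0 := by omega
            rw [glue_of_lt _ _ hp, hg0, hxa]
          · rintro (_ | l) hl
            · rw [glue_of_lt _ _ hp, hg0, hxa]
            · exact (hl 0 (by omega) hxa).elim
          · have h1 := hV.le_birkhoff_glue (m := N i + 1) hg (hadm i) (hgl i)
            have h2 := hw i
            have h3 := hV.sum_le (j i + 1 + 1)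
            have h4 : 0 ≤ ∑ l ∈ Finset.range (1 + 1), |V l| :=
              Finset.sum_nonneg fun i _ => abs_nonneg _
            linarith
      · rw [Fintype.sum_sum_type]
        simp only [Sum.elim_inl, Sum.elim_inr]
        rw [visits_succ', if_pos hxa, birkhoff_succ', add_comm (φ x), Real.exp_add, pow_add,
          pow_one]
        simp_rw [sub_eq_add_neg _ (K + 2 * D), Real.exp_add _ (-(K + 2 * D)), Real.exp_add _ (φ x),
          ← Finset.sum_mul, hsum]
        ring
    · refine ⟨ι, hι, fun i => N i + 1, y', fun i => j i + 1, fun i => r i + φ x, ?_, ?_, ?_⟩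
      · intro i i' h
        simp only [Prod.mk.injEq, Nat.add_right_cancel_iff] at h
        exact hinj' i i' h.1 h.2
      · intro i
        exact ⟨Nat.succ_le_succ (hy i).1, hadm i, hshift i, by simp, hagree i,
            fun l hl => hfirst i l fun k _ hk => hl k hk, hw i⟩
      · rw [visits_succ', if_neg hxa, birkhoff_succ', add_comm (φ x), Real.exp_add, zero_add]
        simp_rw [Real.exp_add _ (φ x), ← Finset.sum_mul, hsum]
        ring

/-- If the partition functions at `a` are summable, then every periodic orbit through `a` loses a
definite amount of weight at each visit to `a`. -/
theorem birkhoff_add_visits_le {M : ℕ → ℕ → Prop} {φ : Pt → ℝ} {V : ℕ → ℝ} {D K : ℝ} {a : ℕ}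
    (hV : VarBound M φ V D)
    (hloop : ∀ x : Pt, ∃ (g : Pt) (p : ℕ), isAdmissible M g ∧ 0 < p ∧ g 0 = a ∧ g p = a ∧
      (∀ i, 0 < i → i < p → g i ≠ a) ∧ (∃ i ≤ p, x i ≠ g i) ∧ -K ≤ birkhoff φ p g)
    (hZ : ∑' n : {n : ℕ // 0 < n}, Zn M φ a n ≠ ⊤) {n : ℕ} (hn : 0 < n) {x : Pt}
    (hx : x ∈ PerSet M a n) :
    birkhoff φ n x + visits a n x * Real.log (1 + Real.exp (-(K + 2 * D))) ≤ 0 := by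
  obtain ⟨hadm, hper, hx0⟩ := hx
  set q : ℝ := 1 + Real.exp (-(K + 2 * D))
  have hq0 : 0 < q := by positivity
  set B := (∑' n : {n : ℕ // 0 < n}, Zn M φ a n).toReal
  have bound : ∀ k : ℕ, 0 < k →
      (Real.exp (birkhoff φ n x) * q ^ visits a n x) ^ k ≤ Real.exp (2 * D) * B := by
    intro k hk
    obtain ⟨ι, hι, N, y, j, r, hinj, hy, hsum⟩ :=
      exists_insertions hV hloop x (k * n) x hadm (shift_iterate_mul hper k)
    have hN : ∀ i, 0 < N i := fun i => (Nat.mul_pos hk hn).trans_le (hy i).1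
    have hyx : ∀ i, y i 0 = a := fun i => ((hy i).2.2.2.2.2.1 0 (by simp)).trans hx0
    have hyN : ∀ i, y i (N i) = y i 0 := fun i => by
      have := congrFun (hy i).2.2.1 0
      rw [shift_iterate_apply, add_zero] at this
      rw [this, hx0, hyx]
    have hmem : ∀ i, periodize (N i) (y i) ∈ PerSet M a (N i) := fun i =>
      ⟨(hy i).2.1.periodize (hN i) (hyN i), shift_periodize _ _, by
        rw [periodize_of_lt _ (hN i), hyx]⟩
    let f : ι → (Σ n : {n : ℕ // 0 < n}, PerSet M a n) := fun i =>
      ⟨⟨N i, hN i⟩, ⟨periodize (N i) (y i), hmem i⟩⟩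
    have hf : Function.Injective f := by
      have aux : ∀ s t : (Σ n : {n : ℕ // 0 < n}, PerSet M a n), s = t →
          s.1.1 = t.1.1 ∧ s.2.1 = t.2.1 := by
        rintro s _ rfl
        exact ⟨rfl, rfl⟩
      intro i i' h
      obtain ⟨h1, h2⟩ := aux _ _ h
      simp only [f] at h1 h2
      refine hinj (Prod.ext h1 ?_)
      ext l
      simp only
      rcases lt_or_ge l (N i) with hl | hl
      · have := congrFun h2 l
        rwa [periodize_of_lt _ hl, periodize_of_lt _ (h1 ▸ hl)] at this
      · obtain ⟨l, rfl⟩ := Nat.exists_eq_add_of_le hl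
        rw [← shift_iterate_apply (N i) (y i), (hy i).2.2.1, h1,
          ← shift_iterate_apply (N i') (y i'), (hy i').2.2.1]
    let w : (Σ n : {n : ℕ // 0 < n}, PerSet M a n) → ℝ≥0∞ := fun s =>
      ENNReal.ofReal (Real.exp (birkhoff φ s.1 s.2.1))
    have h1 : ∑ i, w (f i) ≤ ∑' n : {n : ℕ // 0 < n}, Zn M φ a n := by
      have := ENNReal.tsum_comp_le_tsum_of_injective hf w
      rw [tsum_fintype] at this
      exact this.trans_eq (ENNReal.tsum_sigma' w)
    have h2 : ∑ i, Real.exp (birkhoff φ (N i) (periodize (N i) (y i))) ≤ B := by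
      have := ENNReal.toReal_mono hZ h1
      rw [← ENNReal.ofReal_sum_of_nonneg fun i _ => (Real.exp_pos _).le,
        ENNReal.toReal_ofReal (Finset.sum_nonneg fun i _ => (Real.exp_pos _).le)] at this
      exact this
    have h3 : ∀ i, Real.exp (r i) ≤
        Real.exp (2 * D) * Real.exp (birkhoff φ (N i) (periodize (N i) (y i))) := by
      intro i
      rw [← Real.exp_add, Real.exp_le_exp]
      have h4 := hV.sum_le (j i + 1)
      have h5 := (abs_le.1 (hV.birkhoff_sub_le (N i) _ _ (hmem i).1 (hy i).2.1
        fun l hl => periodize_of_le (hyN i) hl)).1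
      have h6 := (hy i).2.2.2.2.2.2
      linarith
    calc (Real.exp (birkhoff φ n x) * q ^ visits a n x) ^ k
        = ∑ i, Real.exp (r i) := by
          rw [hsum, birkhoff_mul φ hper, visits_mul a hper, mul_pow, ← Real.exp_nat_mul, ← pow_mul,
            mul_comm k (visits a n x)]
      _ ≤ ∑ i, Real.exp (2 * D) * Real.exp (birkhoff φ (N i) (periodize (N i) (y i))) :=
          Finset.sum_le_sum fun i _ => h3 i
      _ ≤ Real.exp (2 * D) * B := by
          rw [← Finset.mul_sum]
          exact mul_le_mul_of_nonneg_left h2 (Real.exp_pos _).le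
  by_contra! hlt
  have hgt : 1 < Real.exp (birkhoff φ n x) * q ^ visits a n x := by
    rw [← Real.exp_log hq0, ← Real.exp_nat_mul, ← Real.exp_add]
    exact Real.one_lt_exp_iff.2 hlt
  obtain ⟨k, hk⟩ := pow_unbounded_of_one_lt (Real.exp (2 * D) * B) hgt
  have h1 := bound (k + 1) k.succ_pos
  have h2 := pow_le_pow_right₀ hgt.le (Nat.le_succ k)
  exact absurd (hk.trans_le (h2.trans h1)) (lt_irrefl _)

theorem exists_exp_bound_of_limsup_lt {u : ℕ → ℝ≥0∞} (hu : ∀ n, 0 < n → u n ≠ ⊤) {R : ℝ}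
    (h : Filter.limsup (fun n : ℕ => ((n : ℝ)⁻¹ : EReal) * ENNReal.log (u n)) atTop < (R : EReal)) :
    ∃ C : ℝ, 1 ≤ C ∧ ∀ n : ℕ, 0 < n → u n ≤ ENNReal.ofReal (C * Real.exp (n * R)) := by
  have hev : ∀ᶠ n : ℕ in atTop, u n ≤ ENNReal.ofReal (Real.exp (n * R)) := by
    filter_upwards [Filter.eventually_lt_of_limsup_lt h, eventually_gt_atTop 0] with n hn hn0
    have hn' : (0 : EReal) < (n : ℝ) := by exact_mod_cast hn0
    rw [← EReal.div_eq_inv_mul, EReal.div_lt_iff hn' (EReal.coe_ne_top _), mul_comm,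
      ← EReal.coe_mul] at hn
    have := EReal.exp_monotone hn.le
    rwa [ENNReal.exp_log, EReal.exp_coe] at this
  obtain ⟨n₀, hn₀⟩ := eventually_atTop.1 hev
  refine ⟨1 + ∑ i ∈ Finset.range n₀, (u i).toReal * Real.exp (-(i * R)), ?_, fun n hn => ?_⟩
  · have : 0 ≤ ∑ i ∈ Finset.range n₀, (u i).toReal * Real.exp (-(i * R)) :=
      Finset.sum_nonneg fun i _ => by positivity
    linarith
  · have hnonneg : ∀ i ∈ Finset.range n₀, 0 ≤ (u i).toReal * Real.exp (-(i * R)) :=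
      fun i _ => by positivity
    rcases lt_or_ge n n₀ with h1 | h1
    · rw [← ENNReal.ofReal_toReal (hu n hn)]
      refine ENNReal.ofReal_le_ofReal ?_
      have h2 := Finset.single_le_sum hnonneg (Finset.mem_range.2 h1)
      calc (u n).toReal = (u n).toReal * Real.exp (-(n * R)) * Real.exp (n * R) := by
            rw [mul_assoc, ← Real.exp_add]; simp
        _ ≤ _ := by
            refine mul_le_mul_of_nonneg_right ?_ (Real.exp_pos _).le
            linarith
    · refine (hn₀ n h1).trans (ENNReal.ofReal_le_ofReal ?_)
      refine le_mul_of_one_le_left (Real.exp_pos _).le ?_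
      linarith [Finset.sum_nonneg hnonneg]

theorem FProperty.Zn_ne_top {M : ℕ → ℕ → Prop} (hF : FProperty M) (φ : Pt → ℝ) (a : ℕ) {n : ℕ}
    (hn : 0 < n) : Zn M φ a n ≠ ⊤ := by
  have := (hF a n hn).fintype
  rw [Zn, tsum_fintype]
  exact ENNReal.sum_ne_top.2 fun _ _ => ENNReal.ofReal_ne_top

theorem ZnStar_le_Zn (M : ℕ → ℕ → Prop) (φ : Pt → ℝ) (a n : ℕ) : ZnStar M φ a n ≤ Zn M φ a n :=
  ENNReal.tsum_mono_subtype (fun x => ENNReal.ofReal (Real.exp (birkhoff φ n x)))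
    fun _ hx => ⟨hx.1, hx.2.1, hx.2.2.1⟩

theorem Zn_sub_const (M : ℕ → ℕ → Prop) (φ : Pt → ℝ) (c : ℝ) (a n : ℕ) :
    Zn M (fun y => φ y - c) a n = Zn M φ a n * ENNReal.ofReal (Real.exp (-(n * c))) := by
  rw [Zn, Zn, ← ENNReal.tsum_mul_right]
  refine tsum_congr fun x => ?_
  rw [birkhoff_sub_const, sub_eq_add_neg, Real.exp_add, ENNReal.ofReal_mul (Real.exp_pos _).le]

theorem tsum_Zn_sub_const_ne_top {M : ℕ → ℕ → Prop} (hF : FProperty M) {φ : Pt → ℝ} {a : ℕ}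
    {P R : ℝ} (hP : pressureAt M φ a ≤ P) (hR : P < R) :
    ∑' n : {n : ℕ // 0 < n}, Zn M (fun y => φ y - R) a n ≠ ⊤ := by
  obtain ⟨R', h1, h2⟩ := exists_between hR
  obtain ⟨C, hC, hbound⟩ := exists_exp_bound_of_limsup_lt (fun n hn => hF.Zn_ne_top φ a hn)
    (hP.trans_lt (EReal.coe_lt_coe_iff.2 h1))
  have hs : Summable fun n : ℕ => C * Real.exp (n * (R' - R)) :=
    (Real.summable_exp_nat_mul_iff.2 (sub_neg.2 h2)).mul_left C
  refine ne_top_of_le_ne_top hs.tsum_ofReal_ne_top ?_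
  refine le_trans (ENNReal.tsum_le_tsum fun n => ?_) (ENNReal.tsum_comp_le_tsum_of_injective
    Subtype.val_injective fun n : ℕ => ENNReal.ofReal (C * Real.exp (n * (R' - R))))
  rw [Zn_sub_const]
  refine (mul_le_mul_left (hbound n n.2) _).trans_eq ?_
  rw [← ENNReal.ofReal_mul (by positivity), mul_assoc, ← Real.exp_add]
  congr 3
  ring

theorem TopTransitive.exists_loop {M : ℕ → ℕ → Prop} (h : TopTransitive M) {a b : ℕ}
    (hab : b ≠ a) :
    ∃ (g : Pt) (p : ℕ), isAdmissible M g ∧ 0 < p ∧ g 0 = a ∧ g p = a ∧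
      (∀ i, 0 < i → i < p → g i ≠ a) ∧ ∃ i < p, g i = b := by
  classical
  obtain ⟨N, x, hx, hx0, hxN⟩ := h a b
  obtain ⟨L, y, hy, hy0, hyL⟩ := h b a
  set s := Nat.findGreatest (fun i => x i = a) N
  have hsa : x s = a := Nat.findGreatest_spec (P := fun i => x i = a) (Nat.zero_le N) hx0
  have hsN : s < N := lt_of_le_of_ne (Nat.findGreatest_le N) fun h => hab (by rw [← hxN, ← h, hsa])
  have hex : ∃ t, y t = a := ⟨L, hyL⟩
  set t := Nat.find hex
  have hta : y t = a := Nat.find_spec hex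
  have ht0 : 0 < t := Nat.pos_of_ne_zero fun h => hab (by rw [← hy0, ← h, hta])
  have hglue : shiftMap^[s] x (N - s) = y 0 := by
    rw [shift_iterate_apply, Nat.add_sub_cancel' hsN.le, hxN, hy0]
  refine ⟨glue (N - s) (shiftMap^[s] x) y, (N - s) + t, (hx.shift s).glue hy hglue, by omega,
    ?_, ?_, ?_, N - s, by omega, ?_⟩
  · rw [glue_of_lt _ _ (by omega), shift_iterate_apply, add_zero, hsa]
  · rw [glue_add, hta]
  · intro i hi hit
    rcases lt_or_ge i (N - s) with h1 | h1
    · rw [glue_of_lt _ _ h1, shift_iterate_apply]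
      exact Nat.findGreatest_is_greatest (P := fun i => x i = a) (n := N) (by omega) (by omega)
    · obtain ⟨l, rfl⟩ := Nat.exists_eq_add_of_le h1
      rw [glue_add]
      exact Nat.find_min hex (by omega)
  · exact (glue_add (N - s) 0 _ y).trans hy0

/-- Two distinct first-return loops at `a`: no sequence follows both of them. -/
theorem TopTransitive.exists_two_loops {M : ℕ → ℕ → Prop} (h : TopTransitive M) (a : ℕ) :
    ∃ S : Finset (Pt × ℕ), ∀ x : Pt, ∃ g p, (g, p) ∈ S ∧ isAdmissible M g ∧ 0 < p ∧ g 0 = a ∧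
      g p = a ∧ (∀ i, 0 < i → i < p → g i ≠ a) ∧ ∃ i ≤ p, x i ≠ g i := by
  classical
  obtain ⟨u, p, hu, hp, hu0, hup, hui, -⟩ := h.exists_loop (Nat.succ_ne_self a)
  obtain ⟨c, hc⟩ := Infinite.exists_notMem_finset (insert a ((Finset.range p).image u))
  simp only [Finset.mem_insert, Finset.mem_image, Finset.mem_range, not_or, not_exists,
    not_and] at hc
  obtain ⟨v, q, hv, hq, hv0, hvq, hvi, i, hi, hic⟩ := h.exists_loop hc.1
  refine ⟨{(u, p), (v, q)}, fun x => ?_⟩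
  by_cases hxu : ∃ i ≤ p, x i ≠ u i
  · exact ⟨u, p, by simp, hu, hp, hu0, hup, hui, hxu⟩
  · push Not at hxu
    refine ⟨v, q, by simp, hv, hq, hv0, hvq, hvi, ?_⟩
    by_contra! hxv
    rcases lt_or_ge i p with h1 | h1
    · exact hc.2 i h1 (by rw [← hxu i h1.le, hxv i hi.le, hic])
    · exact hvi p hp (by omega) (by rw [← hxv p (by omega), hxu p le_rfl, hup])

/-- Every periodic orbit through `a` loses a definite amount of weight, relative to the pressure,
at each visit to `a`. -/
theorem exists_birkhoff_le_sub_visits {M : ℕ → ℕ → Prop} {φ : Pt → ℝ} {V : ℕ → ℝ} {D : ℝ}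
    (hV : VarBound M φ V D) (htrans : TopTransitive M) (hF : FProperty M) {P : ℝ} {a : ℕ}
    (hP : pressureAt M φ a ≤ P) :
    ∃ c : ℝ, 0 < c ∧ ∀ n x, 0 < n → x ∈ PerSet M a n →
      birkhoff φ n x ≤ n * P - c * visits a n x := by
  obtain ⟨S, hS⟩ := htrans.exists_two_loops a
  set K : ℝ := ∑ s ∈ S, (|birkhoff φ s.2 s.1| + s.2 * (|P| + 1))
  have hKs : ∀ s ∈ S, |birkhoff φ s.2 s.1| + s.2 * (|P| + 1) ≤ K := fun s hs =>
    Finset.single_le_sum (f := fun s : Pt × ℕ => |birkhoff φ s.2 s.1| + s.2 * (|P| + 1))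
      (fun s _ => by positivity) hs
  set c := Real.log (1 + Real.exp (-(K + 2 * D)))
  refine ⟨c, Real.log_pos (by linarith [Real.exp_pos (-(K + 2 * D))]), fun n x hn hx => ?_⟩
  have key : ∀ ε : ℝ, 0 < ε → ε ≤ 1 → birkhoff φ n x + visits a n x * c ≤ n * P + n * ε := by
    intro ε hε hε1
    have := birkhoff_add_visits_le (hV.sub_const (P + ε)) (K := K) ?_
      (tsum_Zn_sub_const_ne_top hF hP (lt_add_of_pos_right P hε)) hn hx
    · rw [birkhoff_sub_const] at this
      linarith
    · intro x
      obtain ⟨g, p, hgp, h1, h2, h3, h4, h5, h6⟩ := hS x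
      refine ⟨g, p, h1, h2, h3, h4, h5, h6, ?_⟩
      have h7 := hKs _ hgp
      have h8 : (p : ℝ) * (P + ε) ≤ p * (|P| + 1) :=
        mul_le_mul_of_nonneg_left (add_le_add (le_abs_self P) hε1) (Nat.cast_nonneg p)
      rw [birkhoff_sub_const]
      linarith [neg_abs_le (birkhoff φ p g)]
  have hn' : (0 : ℝ) < n := by exact_mod_cast hn
  by_contra! hlt
  set δ := birkhoff φ n x - (n * P - c * visits a n x) with hδ
  have hδ0 : 0 < δ := sub_pos.2 hlt
  have h1 := key (min 1 (δ / (2 * n))) (by positivity) (min_le_left _ _)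
  have h2 : (n : ℝ) * min 1 (δ / (2 * n)) ≤ δ / 2 := by
    calc (n : ℝ) * min 1 (δ / (2 * n)) ≤ n * (δ / (2 * n)) :=
          mul_le_mul_of_nonneg_left (min_le_right _ _) hn'.le
      _ = δ / 2 := by field_simp
  linarith

/-- Orbit segments from `a` to `a` gain weight at rate at most `R`, up to a constant at each visit
to `a`, if the first-return partition functions grow at rate at most `R`. -/
theorem birkhoff_le_of_ZnStar_le {M : ℕ → ℕ → Prop} {φ : Pt → ℝ} {V : ℕ → ℝ} {D : ℝ}
    (hV : VarBound M φ V D) {R C : ℝ} {a : ℕ} (hC : 1 ≤ C)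
    (hZ : ∀ n : ℕ, 0 < n → ZnStar M φ a n ≤ ENNReal.ofReal (C * Real.exp (n * R))) (n : ℕ) (x : Pt)
    (hx : isAdmissible M x) (hx0 : x 0 = a) (hxn : x n = a) :
    birkhoff φ n x ≤ n * R + (Real.log C + D) * visits a n x := by
  classical
  induction n using Nat.strong_induction_on generalizing x with
  | _ n ih =>
    rcases Nat.eq_zero_or_pos n with rfl | hn
    · simp [birkhoff, visits]
    have hex : ∃ l, 0 < l ∧ x l = a := ⟨n, hn, hxn⟩
    set l := Nat.find hex
    obtain ⟨hl0, hla⟩ : 0 < l ∧ x l = a := Nat.find_spec hex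
    have hmin : ∀ k, 0 < k → k < l → x k ≠ a := fun k hk hkl h => Nat.find_min hex hkl ⟨hk, h⟩
    have hln : l ≤ n := Nat.find_min' hex ⟨hn, hxn⟩
    obtain ⟨m, rfl⟩ := Nat.exists_eq_add_of_le hln
    have hxl : x l = x 0 := hla.trans hx0.symm
    have hmem : periodize l x ∈ PerStarSet M a l :=
      ⟨hx.periodize hl0 hxl, shift_periodize _ _, by rw [periodize_of_lt _ hl0, hx0],
        fun k hk hkl => by rw [periodize_of_lt _ hkl]; exact hmin k hk hkl⟩
    have h1 : birkhoff φ l (periodize l x) ≤ Real.log C + l * R := by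
      have h2 := (ENNReal.le_tsum (f := fun y : PerStarSet M a l =>
        ENNReal.ofReal (Real.exp (birkhoff φ l y.1))) ⟨_, hmem⟩).trans (hZ l hl0)
      rw [ENNReal.ofReal_le_ofReal_iff (by positivity)] at h2
      rwa [← Real.exp_le_exp, Real.exp_add, Real.exp_log (by linarith)]
    have h3 := (abs_le.1 (hV.birkhoff_sub_le l _ _ hmem.1 hx fun i hi => periodize_of_le hxl hi)).1
    have h4 := ih m (by omega) (shiftMap^[l] x) (hx.shift l)
      (by rw [shift_iterate_apply, add_zero, hla]) (by rw [shift_iterate_apply, hxn])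
    have h5 : visits a l x = 1 := by
      rw [visits, Finset.sum_eq_single_of_mem 0 (Finset.mem_range.2 hl0), if_pos hx0]
      intro k hk hk0
      exact if_neg (hmin k (Nat.pos_of_ne_zero hk0) (Finset.mem_range.1 hk))
    rw [birkhoff_add, visits_add, h5]
    push_cast
    linarith

/-- A linear bound on the Birkhoff sums along orbit segments from `a` to `a` bounds the average
along every periodic orbit. -/
theorem birkhoff_le_of_forall_return {M : ℕ → ℕ → Prop} {φ : Pt → ℝ} {V : ℕ → ℝ} {D E κ : ℝ}
    (hV : VarBound M φ V D) (htrans : TopTransitive M) {a : ℕ}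
    (hret : ∀ n x, 0 < n → isAdmissible M x → x 0 = a → x n = a → birkhoff φ n x ≤ n * κ + E)
    {n : ℕ} (hn : 0 < n) {y : Pt} (hy : isAdmissible M y) (hper : shiftMap^[n] y = y) :
    birkhoff φ n y ≤ n * κ := by
  obtain ⟨N, u, hu, hu0, huN⟩ := htrans a (y 0)
  obtain ⟨L, v, hv, hv0, hvL⟩ := htrans (y 0) a
  set B := (N + L) * κ + E + 2 * D - birkhoff φ N u - birkhoff φ L v with hB
  have key : ∀ k : ℕ, 0 < k → k * (birkhoff φ n y - n * κ) ≤ B := by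
    intro k hk
    have hkn : 0 < k * n := Nat.mul_pos hk hn
    have hyv : y (k * n) = v 0 := by
      rw [hv0]
      simpa [shift_iterate_apply] using congrFun (shift_iterate_mul hper k) 0
    set w := glue (k * n) y v
    have hw : isAdmissible M w := hy.glue hv hyv
    have huw : u N = w 0 := by rw [huN]; exact (glue_of_lt _ _ hkn).symm
    have h1 := hret (N + (k * n + L)) (glue N u w) (by omega) (hu.glue hw huw)
      (by rw [glue_of_le huw (Nat.zero_le _), hu0]) (by rw [glue_add, ← hvL]; exact glue_add _ _ _ _)
    have h2 := hV.le_birkhoff_glue (m := k * n + L) hu hw huw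
    have h3 := hV.le_birkhoff_glue (m := L) hy hv hyv
    rw [birkhoff_mul φ hper] at h3
    push_cast at h1
    linarith
  by_contra! hlt
  obtain ⟨k, hk⟩ := exists_nat_gt (B / (birkhoff φ n y - n * κ))
  have hpos := sub_pos.2 hlt
  rw [div_lt_iff₀ hpos] at hk
  have h1 := key (k + 1) k.succ_pos
  push_cast at h1
  linarith

end CMS

/-- Proposition `SPR implies UCS`.
For a topologically transitive countable Markov shift with the F-property, a
potential `φ` with summable variations, finite Gurevich pressure `P = P(φ)` and
entropy at infinity `h_∞ = 0`: if `φ` is strongly positive recurrent then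
`χ_per(φ) < P(φ)`, i.e. (UCS) holds. -/
theorem SPR_implies_UCS
    (M : ℕ → ℕ → Prop) (φ : Pt → ℝ)
    (htrans : TopTransitive M) (hF : FProperty M)
    (hsum : SummableVariations M φ)
    (P : ℝ) (hP : ∀ a : ℕ, pressureAt M φ a = (P : EReal))
    (hinf : hInfty M = (0 : EReal))
    (hSPR : SPR M φ P) :
    chiPer M φ < (P : EReal) := by
  obtain ⟨V, hVs, hVar⟩ := hsum
  have hV : VarBound M φ V (∑' i, |V i|) :=
    ⟨hVar, fun s => hVs.abs.sum_le_tsum _ fun i _ => abs_nonneg _⟩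
  obtain ⟨a, ha⟩ := hSPR
  obtain ⟨R, hR, hRP⟩ := EReal.lt_iff_exists_real_btwn.1 ha
  rw [EReal.coe_lt_coe_iff] at hRP
  obtain ⟨C₀, hC₀, hZ⟩ := exists_exp_bound_of_limsup_lt (u := ZnStar M φ a)
    (fun n hn => ne_top_of_le_ne_top (hF.Zn_ne_top φ a hn) (ZnStar_le_Zn M φ a n)) hR
  obtain ⟨c, hc, hvis⟩ := exists_birkhoff_le_sub_visits hV htrans hF (hP a).le
  set D := ∑' i, |V i|
  set C := Real.log C₀ + D
  have hD : 0 ≤ D := hV.nonneg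
  have hC : 0 ≤ C := add_nonneg (Real.log_nonneg hC₀) hD
  have hCc : 0 < C + c := by linarith
  set κ := (C * P + c * R) / (C + c) with hκ
  have hκP : κ < P := by
    rw [hκ, div_lt_iff₀ hCc]
    linarith [mul_lt_mul_of_pos_left hRP hc]
  have hret : ∀ n x, 0 < n → isAdmissible M x → x 0 = a → x n = a →
      birkhoff φ n x ≤ n * κ + D := by
    intro n x hn hx hx0 hxn
    have hxx : x n = x 0 := hxn.trans hx0.symm
    have hmem : periodize n x ∈ PerSet M a n :=
      ⟨hx.periodize hn hxx, shift_periodize _ _, by rw [periodize_of_lt _ hn, hx0]⟩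
    have h1 := hvis n _ hn hmem
    have hv : visits a n (periodize n x) = visits a n x :=
      Finset.sum_congr rfl fun i hi => by rw [periodize_of_lt _ (Finset.mem_range.1 hi)]
    rw [hv] at h1
    have h2 := (abs_le.1 (hV.birkhoff_sub_le n _ _ hmem.1 hx fun i hi => periodize_of_le hxx hi)).1
    have h3 : birkhoff φ n x ≤ n * R + C * visits a n x :=
      birkhoff_le_of_ZnStar_le hV hC₀ hZ n x hx hx0 hxn
    have h4 : birkhoff φ n x ≤ n * P - c * visits a n x + D := by linarith
    have h5 : κ * (C + c) = C * P + c * R := div_mul_cancel₀ _ hCc.ne'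
    refine le_of_mul_le_mul_right ?_ hCc
    calc birkhoff φ n x * (C + c) = C * birkhoff φ n x + c * birkhoff φ n x := by ring
      _ ≤ C * (n * P - c * visits a n x + D) + c * (n * R + C * visits a n x) :=
          add_le_add (mul_le_mul_of_nonneg_left h4 hC) (mul_le_mul_of_nonneg_left h3 hc.le)
      _ = n * (κ * (C + c)) + C * D := by rw [h5]; ring
      _ ≤ (n * κ + D) * (C + c) := by linarith [mul_nonneg hc.le hD]
  refine lt_of_le_of_lt (iSup_le ?_) (EReal.coe_lt_coe_iff.2 hκP)
  rintro ⟨⟨y, n⟩, hy, hn, hper⟩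
  rw [EReal.coe_le_coe_iff, div_le_iff₀ (by exact_mod_cast hn), mul_comm]
  exact birkhoff_le_of_forall_return hV htrans hret hn hy hper
end

section
/- Let (Σ,σ) be a topologically transitive countable Markov shift with h_top < ∞ and φ : Σ → ℝ a potential with summable variations, P(φ) = 0, and δ_{φ,∞} finite. Then for every ε > 0 there exist q ∈ ℕ and K_q ≥ 0 such that for all n ≥ 1: if x ∈ Σ satisfies x_0 ≤ q, x_n ≤ q, and x_k > q for all 1 ≤ k ≤ n−1, then S_nφ(x) < K_q + n(δ_{φ,∞} + ε). -/
open Filter Set MeasureTheory Real ENNReal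

open CMS

namespace CMS

variable {M : ℕ → ℕ → Prop} {φ : Pt → ℝ}

lemma shiftMap_iterate_apply (n : ℕ) (x : Pt) (i : ℕ) : shiftMap^[n] x i = x (i + n) := by
  induction n generalizing x with
  | zero => rfl
  | succ n ih =>
    rw [Function.iterate_succ_apply, ih]
    simp only [shiftMap]
    congr 1

lemma isAdmissible.shiftMap_iterate {x : Pt} (hx : isAdmissible M x) (n : ℕ) :
    isAdmissible M (shiftMap^[n] x) := by
  intro i
  rw [shiftMap_iterate_apply, shiftMap_iterate_apply, show i + 1 + n = i + n + 1 by omega]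
  exact hx (i + n)

lemma PerSet_subset_PerSet_mul (a n k : ℕ) : PerSet M a n ⊆ PerSet M a (n * k) := by
  rintro x ⟨hx, hper, h0⟩
  refine ⟨hx, ?_, h0⟩
  rw [Function.iterate_mul]
  exact Function.iterate_fixed hper k

/-- Finite entropy implies the `F`-property. -/
lemma FProperty_of_pressureAt_lt_top
    (h : ∀ a : ℕ, pressureAt M (fun _ => (0 : ℝ)) a < ⊤) : FProperty M := by
  intro a n hn
  by_contra hinf
  have hZ : ∀ k : ℕ, Zn M (fun _ => (0 : ℝ)) a (n * (k + 1)) = ⊤ := by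
    intro k
    have : Infinite (PerSet M a (n * (k + 1))) :=
      (Set.Infinite.mono (PerSet_subset_PerSet_mul a n (k + 1)) hinf).to_subtype
    simp [Zn, birkhoff]
  obtain ⟨N, hN⟩ := eventually_atTop.1 (eventually_lt_of_limsup_lt (h a))
  have hlt := hN (n * (N + 1)) (by nlinarith)
  rw [hZ, ENNReal.log_top] at hlt
  have hpos : (0 : ℝ) < (((n * (N + 1) : ℕ) : ℝ))⁻¹ := by positivity
  rw [← EReal.coe_inv, EReal.mul_top_of_pos (EReal.coe_pos.2 hpos)] at hlt
  exact lt_irrefl _ hlt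

/-- Repeating a closed admissible word gives an admissible periodic point. -/
lemma exists_mem_PerSet_of_closed {w : Pt} {L : ℕ} (hL : 0 < L)
    (hw : ∀ i < L, M (w i) (w (i + 1))) (hclosed : w L = w 0) :
    ∃ z ∈ PerSet M (w 0) L, ∀ i ≤ L, z i = w i := by
  refine ⟨fun i => w (i % L), ⟨fun i => ?_, ?_, by simp⟩, fun i hi => ?_⟩
  · have hlt := Nat.mod_lt i hL
    have hstep := hw _ hlt
    dsimp only
    rcases Nat.lt_or_ge (i % L + 1) L with h | h
    · rwa [show (i + 1) % L = i % L + 1 by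
        rw [Nat.add_mod_eq_ite, if_neg, Nat.mod_eq_of_lt (show 1 < L by omega)]
        rw [Nat.mod_eq_of_lt (show 1 < L by omega)]; omega]
    · have h1 : i % L + 1 = L := by omega
      rw [h1, hclosed] at hstep
      rwa [show (i + 1) % L = 0 by rw [← Nat.mod_add_mod, h1, Nat.mod_self]]
  · funext i
    simp [shiftMap_iterate_apply]
  · rcases hi.lt_or_eq with h | rfl
    · simp [Nat.mod_eq_of_lt h]
    · simp [hclosed]

/-- Words from `a` to `b` of length `n + 1` extend to periodic points of a common period. -/
lemma TopTransitive.exists_periodic_extension (htrans : TopTransitive M) (a b : ℕ) {n : ℕ}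
    (hn : 0 < n) :
    ∃ L, 0 < L ∧ ∀ x : Pt, isAdmissible M x → x 0 = a → x n = b →
      ∃ z ∈ PerSet M a L, ∀ i ≤ n, z i = x i := by
  obtain ⟨N, y, hy, hy0, hyN⟩ := htrans b a
  refine ⟨n + N, by omega, fun x hx hx0 hxn => ?_⟩
  let w : Pt := fun j => if j ≤ n then x j else y (j - n)
  have hwx : ∀ i ≤ n, w i = x i := fun i hi => if_pos hi
  have hwy : ∀ i, w (n + i) = y i := by
    intro i
    rcases Nat.eq_zero_or_pos i with rfl | hi
    · rw [add_zero, hwx n le_rfl, hxn, hy0]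
    · simp only [w]
      rw [if_neg (by omega), Nat.add_sub_cancel_left]
  have hw : ∀ i < n + N, M (w i) (w (i + 1)) := by
    intro i _
    rcases Nat.lt_or_ge i n with hi | hi
    · rw [hwx i hi.le, hwx (i + 1) hi]
      exact hx i
    · obtain ⟨j, rfl⟩ := Nat.exists_eq_add_of_le hi
      rw [add_assoc, hwy, hwy]
      exact hy j
  have hw0 : w 0 = a := by rw [hwx 0 (Nat.zero_le n), hx0]
  obtain ⟨z, hz, hzw⟩ := exists_mem_PerSet_of_closed (show 0 < n + N by omega) hw
    (by rw [hwy, hyN, hw0])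
  rw [hw0] at hz
  exact ⟨z, hz, fun i hi => (hzw i (by omega)).trans (hwx i hi)⟩

/-- Bounded distortion of `S_n φ` on `(n + 1)`-cylinders. -/
lemma SummableVariations.exists_birkhoff_le (hsum : SummableVariations M φ) (n : ℕ) :
    ∃ C : ℝ, ∀ x y : Pt, isAdmissible M x → isAdmissible M y → (∀ i ≤ n, x i = y i) →
      birkhoff φ n x ≤ birkhoff φ n y + C := by
  obtain ⟨V, -, hV⟩ := hsum
  refine ⟨∑ i ∈ Finset.range n, V (n + 1 - i), fun x y hx hy hxy => ?_⟩
  simp only [birkhoff]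
  rw [← Finset.sum_add_distrib]
  refine Finset.sum_le_sum fun i hi => ?_
  have hin := Finset.mem_range.1 hi
  have h := hV (n + 1 - i) (by omega) _ _ (hx.shiftMap_iterate i) (hy.shiftMap_iterate i)
    fun j hj => by
      rw [shiftMap_iterate_apply, shiftMap_iterate_apply]
      exact hxy _ (by omega)
  linarith [(abs_le.1 h).2]

/-- `S_n φ` is bounded above on the points starting in `[a]` and reaching `[b]` at time `n`. -/
lemma exists_birkhoff_le_of_endpoints (htrans : TopTransitive M) (hF : FProperty M)
    (hsum : SummableVariations M φ) (a b : ℕ) {n : ℕ} (hn : 0 < n) :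
    ∃ C : ℝ, ∀ x : Pt, isAdmissible M x → x 0 = a → x n = b → birkhoff φ n x ≤ C := by
  obtain ⟨L, hL, hper⟩ := htrans.exists_periodic_extension a b hn
  obtain ⟨C, hC⟩ := hsum.exists_birkhoff_le n
  obtain ⟨B, hB⟩ := ((hF a L hL).image (birkhoff φ n)).bddAbove
  refine ⟨B + C, fun x hx hx0 hxn => ?_⟩
  obtain ⟨z, hz, hzx⟩ := hper x hx hx0 hxn
  have h1 := hC x z hx hz.1 fun i hi => (hzx i hi).symm
  have h2 := hB (Set.mem_image_of_mem _ hz)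
  linarith

lemma exists_birkhoff_le_of_endpoints_le (htrans : TopTransitive M) (hF : FProperty M)
    (hsum : SummableVariations M φ) (q : ℕ) {n : ℕ} (hn : 0 < n) :
    ∃ C : ℝ, ∀ x : Pt, isAdmissible M x → x 0 ≤ q → x n ≤ q → birkhoff φ n x ≤ C := by
  choose C hC using fun p : ℕ × ℕ => exists_birkhoff_le_of_endpoints htrans hF hsum p.1 p.2 hn
  obtain ⟨B, hB⟩ := ((Set.toFinite (Set.Iic q ×ˢ Set.Iic q)).image C).bddAbove
  exact ⟨B, fun x hx h0 hxn => (hC (x 0, x n) x hx rfl rfl).trans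
    (hB (Set.mem_image_of_mem _ (Set.mk_mem_prod h0 hxn)))⟩

lemma inBSet_of_no_intermediate_return {n M' q : ℕ} (hM' : 0 < M') (hn : 2 * M' ≤ n) {x : Pt}
    (hx : isAdmissible M x) (h0 : x 0 ≤ q) (hxn : x n ≤ q)
    (hk : ∀ k : ℕ, 1 ≤ k → k ≤ n - 1 → q < x k) : inBSet M n M' q x := by
  refine ⟨hx, h0, hxn, ?_⟩
  have hsub : (Finset.range (n + 1)).filter (fun k => x k ≤ q) ⊆ {0, n} := by
    intro k hmem
    simp only [Finset.mem_filter, Finset.mem_range, Finset.mem_insert,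
      Finset.mem_singleton] at hmem ⊢
    by_contra hne
    have := hk k (by omega) (by omega)
    omega
  have hcard := (Finset.card_le_card hsub).trans Finset.card_le_two
  have hMpos : (0 : ℝ) < M' := by exact_mod_cast hM'
  rw [le_div_iff₀ hMpos]
  have hmul := (Nat.mul_le_mul_right M' hcard).trans (hn.trans n.le_succ)
  exact_mod_cast hmul

lemma exists_eventually_zPhi_lt {c : EReal} (h : deltaInf M φ < c) :
    ∃ q M', 0 < M' ∧ ∀ᶠ n in atTop, zPhi M φ n M' q < c := by
  obtain ⟨q, hq⟩ := (frequently_lt_of_liminf_lt (by isBoundedDefault) h).exists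
  obtain ⟨M', hlt, hM'⟩ := ((frequently_lt_of_liminf_lt (by isBoundedDefault) hq).and_eventually
    (eventually_gt_atTop 0)).exists
  exact ⟨q, M', hM', eventually_lt_of_limsup_lt hlt⟩

end CMS

/-- Lemma `lem:few_rets`.
Let `(Σ,σ)` be a topologically transitive countable Markov shift with finite
topological entropy `h_top = H < ∞` and `φ` a potential with summable
variations, Gurevich pressure `P(φ) = 0` and finite contraction at infinity
`δ_{φ,∞} = d ∈ ℝ`.  Then for all `ε > 0` there exist `q` and `K_q ≥ 0` such
that for all `n ≥ 1`: if `x 0 ≤ q`, `x n ≤ q` and `x k > q` for `1 ≤ k ≤ n-1`,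
then `S_n φ(x) < K_q + n (δ_{φ,∞} + ε)`. -/
theorem few_returns_contract
    (M : ℕ → ℕ → Prop) (φ : Pt → ℝ)
    (htrans : TopTransitive M)
    (H : ℝ) (hH : ∀ a : ℕ, pressureAt M (fun _ => (0 : ℝ)) a = (H : EReal))
    (hsum : SummableVariations M φ)
    (hP : ∀ a : ℕ, pressureAt M φ a = (0 : EReal))
    (d : ℝ) (hd : deltaInf M φ = (d : EReal)) :
    ∀ ε : ℝ, 0 < ε → ∃ (q : ℕ) (K : ℝ), 0 ≤ K ∧
      ∀ n : ℕ, 1 ≤ n → ∀ x : Pt, isAdmissible M x →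
        x 0 ≤ q → x n ≤ q → (∀ k : ℕ, 1 ≤ k → k ≤ n - 1 → q < x k) →
        birkhoff φ n x < K + n * (d + ε) := by
  intro ε hε
  have hF : FProperty M :=
    FProperty_of_pressureAt_lt_top fun a => by rw [hH a]; exact EReal.coe_lt_top H
  have hlt : deltaInf M φ < ((d + ε : ℝ) : EReal) := by
    rw [hd]
    exact_mod_cast lt_add_of_pos_right d hε
  obtain ⟨q, M', hM', hev⟩ := exists_eventually_zPhi_lt hlt
  obtain ⟨N, hN⟩ := eventually_atTop.1 hev
  have hbound : ∀ n : ℕ, ∃ K : ℝ, 0 ≤ K ∧ (1 ≤ n → ∀ x : Pt, isAdmissible M x →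
      x 0 ≤ q → x n ≤ q → birkhoff φ n x < K + n * (d + ε)) := by
    intro n
    rcases Nat.eq_zero_or_pos n with rfl | hn
    · exact ⟨0, le_rfl, fun h => absurd h (by omega)⟩
    obtain ⟨C, hC⟩ := exists_birkhoff_le_of_endpoints_le htrans hF hsum q hn
    refine ⟨|C - n * (d + ε)| + 1, by positivity, fun _ x hx h0 hxn => ?_⟩
    linarith [hC x hx h0 hxn, le_abs_self (C - n * (d + ε))]
  choose K hK0 hK using hbound
  refine ⟨q, ∑ m ∈ Finset.range (N + 2 * M'), K m, Finset.sum_nonneg fun m _ => hK0 m,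
    fun n hn x hx h0 hxn hk => ?_⟩
  rcases Nat.lt_or_ge n (N + 2 * M') with hsmall | hlarge
  · have hle := Finset.single_le_sum (fun m _ => hK0 m) (Finset.mem_range.2 hsmall)
    linarith [hK n hn x hx h0 hxn]
  · have hmem := inBSet_of_no_intermediate_return hM' (by omega) hx h0 hxn hk
    have hz : ((birkhoff φ n x / (n : ℝ) : ℝ) : EReal) ≤ zPhi M φ n M' q :=
      le_iSup (fun y : {y : Pt // inBSet M n M' q y} =>
        ((birkhoff φ n y.1 / (n : ℝ) : ℝ) : EReal)) ⟨x, hmem⟩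
    have hdiv : birkhoff φ n x / n < d + ε :=
      EReal.coe_lt_coe_iff.1 (hz.trans_lt (hN n (by omega)))
    have hnpos : (0 : ℝ) < n := by exact_mod_cast hn
    rw [div_lt_iff₀ hnpos] at hdiv
    linarith [Finset.sum_nonneg fun m (_ : m ∈ Finset.range (N + 2 * M')) => hK0 m]
end
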